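/- (FN implies FNS.) Let p be a no-signaling correlation with local content q_L^max(p) = 0. Then there exists a face F of the no-signaling set NS such that p ∈ F and F contains no local correlation. -/

import Mathlib

open Finset

variable {A B X Y : Type*} [Fintype A] [Fintype B] [Fintype X] [Fintype Y]
  [DecidableEq A] [DecidableEq B] [DecidableEq X] [DecidableEq Y]

/-- A (bipartite) correlation: nonnegative entries, normalized for each pair of settings. -/
def IsCorrelation (p : A → B → X → Y → ℝ) : Prop :=
  (∀ a b x y, 0 ≤ p a b x y) ∧ (∀ x y, ∑ a, ∑ b, p a b x y = 1)

/-- The no-signaling conditions: Alice's marginal does not depend on Bob's setting and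
vice versa. -/
def NoSignaling (p : A → B → X → Y → ℝ) : Prop :=
  (∀ a x y y', ∑ b, p a b x y = ∑ b, p a b x y') ∧
  (∀ b y x x', ∑ a, p a b x y = ∑ a, p a b x' y)

/-- A no-signaling correlation. -/
def IsNSCorrelation (p : A → B → X → Y → ℝ) : Prop :=
  IsCorrelation p ∧ NoSignaling p

/-- The deterministic local correlation associated to outcome assignments `f`, `g`. -/
def detLocal (f : X → A) (g : Y → B) : A → B → X → Y → ℝ :=
  fun a b x y => (if a = f x then (1:ℝ) else 0) * (if b = g y then (1:ℝ) else 0)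

/-- A local correlation: a convex combination of deterministic local correlations. -/
def IsLocal (p : A → B → X → Y → ℝ) : Prop :=
  ∃ μ : (X → A) × (Y → B) → ℝ, (∀ fg, 0 ≤ μ fg) ∧ (∑ fg, μ fg = 1) ∧
    ∀ a b x y, p a b x y = ∑ fg, μ fg * detLocal fg.1 fg.2 a b x y

/-- The local content `q_L^max` of a correlation: the supremum of the local weight over
all decompositions into a local part and a no-signaling part. -/
noncomputable def localContent (p : A → B → X → Y → ℝ) : ℝ :=
  sSup {q : ℝ | 0 ≤ q ∧ q ≤ 1 ∧ ∃ pL pNL : A → B → X → Y → ℝ,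
    IsLocal pL ∧ IsNSCorrelation pNL ∧
    ∀ a b x y, p a b x y = q * pL a b x y + (1 - q) * pNL a b x y}

/-- The winning probability of a correlation `p` in the nonlocal game `(π, W)`. -/
def winProb (p : A → B → X → Y → ℝ) (pi : X → Y → ℝ) (W : A → B → X → Y → Bool) : ℝ :=
  ∑ a, ∑ b, ∑ x, ∑ y, pi x y * (if W a b x y then (1:ℝ) else 0) * p a b x y

/-- The classical value of a nonlocal game: the maximum winning probability over
deterministic local strategies. -/
noncomputable def classicalValue (pi : X → Y → ℝ) (W : A → B → X → Y → Bool) : ℝ :=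
  ⨆ fg : (X → A) × (Y → B), winProb (detLocal fg.1 fg.2) pi W

/-- The set of no-signaling correlations. -/
def NSSet (A B X Y : Type*) [Fintype A] [Fintype B] [Fintype X] [Fintype Y] :
    Set (A → B → X → Y → ℝ) := {p | IsNSCorrelation p}

/-- A face of the no-signaling set: a subset of `NS` that is extreme in `NS`. -/
def IsFace (F : Set (A → B → X → Y → ℝ)) : Prop :=
  F ⊆ NSSet A B X Y ∧ ∀ p ∈ F, ∀ p₁ ∈ NSSet A B X Y, ∀ p₂ ∈ NSSet A B X Y,
    ∀ t : ℝ, 0 < t → t < 1 →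
    (∀ a b x y, p a b x y = t * p₁ a b x y + (1 - t) * p₂ a b x y) →
    p₁ ∈ F ∧ p₂ ∈ F

/-- A correlation `p` realizes a table of zeros `Z` if it vanishes on every entry of `Z`. -/
def Realizes (p : A → B → X → Y → ℝ) (Z : Set (A × B × X × Y)) : Prop :=
  ∀ a b x y, (a, b, x, y) ∈ Z → p a b x y = 0

/-- A table of zeros is LHV-realizable if some deterministic outcome assignment avoids
all its zeros. -/
def LHVRealizable (Z : Set (A × B × X × Y)) : Prop :=
  ∃ (f : X → A) (g : Y → B), ∀ x y, (f x, g y, x, y) ∉ Z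

omit [Fintype A] [Fintype X] [Fintype Y] [DecidableEq X] [DecidableEq Y] in
lemma sum_detLocal_right (f : X → A) (g : Y → B) (a : A) (x : X) (y : Y) :
    ∑ b, detLocal f g a b x y = if a = f x then 1 else 0 := by
  simp [detLocal]

omit [Fintype B] [Fintype X] [Fintype Y] [DecidableEq X] [DecidableEq Y] in
lemma sum_detLocal_left (f : X → A) (g : Y → B) (b : B) (x : X) (y : Y) :
    ∑ a, detLocal f g a b x y = if b = g y then 1 else 0 := by
  simp [detLocal]

omit [Fintype A] [Fintype B] [Fintype X] [Fintype Y] [DecidableEq X] [DecidableEq Y] in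
lemma detLocal_nonneg (f : X → A) (g : Y → B) (a : A) (b : B) (x : X) (y : Y) :
    0 ≤ detLocal f g a b x y := by
  unfold detLocal
  positivity

lemma isLocal_detLocal (f : X → A) (g : Y → B) : IsLocal (detLocal f g) :=
  ⟨fun fg => if fg = (f, g) then 1 else 0, fun fg => by positivity, by simp, by simp⟩

omit [Fintype X] [Fintype Y] [DecidableEq X] [DecidableEq Y] in
/-- Removing a deterministic local correlation of weight `q < 1` that fits below a no-signaling
correlation `p` leaves, after renormalization, a no-signaling correlation. -/
lemma IsNSCorrelation.sub_detLocal {p : A → B → X → Y → ℝ} (hp : IsNSCorrelation p)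
    (f : X → A) (g : Y → B) {q : ℝ} (hq : q < 1)
    (hle : ∀ a b x y, q * detLocal f g a b x y ≤ p a b x y) :
    IsNSCorrelation fun a b x y => (1 - q)⁻¹ * (p a b x y - q * detLocal f g a b x y) := by
  have hq' : 0 < 1 - q := sub_pos.2 hq
  obtain ⟨⟨-, hsum⟩, hA, hB⟩ := hp
  refine ⟨⟨fun a b x y => mul_nonneg (inv_pos.2 hq').le (sub_nonneg.2 (hle a b x y)),
    fun x y => ?_⟩, fun a x y y' => ?_, fun b y x x' => ?_⟩
  · simp only [← mul_sum, sum_sub_distrib, hsum, sum_detLocal_right]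
    simp [hq'.ne']
  · simp only [← mul_sum, sum_sub_distrib, sum_detLocal_right, hA a x y y']
  · simp only [← mul_sum, sum_sub_distrib, sum_detLocal_left, hB b y x x']

lemma le_localContent {p : A → B → X → Y → ℝ} (hp : IsNSCorrelation p)
    (f : X → A) (g : Y → B) {q : ℝ} (hq0 : 0 ≤ q) (hq : q < 1)
    (hle : ∀ x y, q ≤ p (f x) (g y) x y) : q ≤ localContent p := by
  have hle' : ∀ a b x y, q * detLocal f g a b x y ≤ p a b x y := by
    intro a b x y
    by_cases h : a = f x ∧ b = g y
    · obtain ⟨rfl, rfl⟩ := h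
      simpa [detLocal] using hle x y
    · have h' : detLocal f g a b x y = 0 := by
        rcases not_and_or.1 h with h | h <;> simp [detLocal, h]
      simpa [h'] using hp.1.1 a b x y
  refine le_csSup ⟨1, fun r hr => hr.2.1⟩ ⟨hq0, hq.le, _, _, isLocal_detLocal f g,
    hp.sub_detLocal f g hq hle', fun a b x y => ?_⟩
  have : 1 - q ≠ 0 := (sub_pos.2 hq).ne'
  field_simp
  ring

lemma localContent_pos {p : A → B → X → Y → ℝ} (hp : IsNSCorrelation p)
    (f : X → A) (g : Y → B) (hpos : ∀ x y, 0 < p (f x) (g y) x y) : 0 < localContent p := by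
  obtain ⟨ε, hε, hle⟩ : ∃ ε : ℝ, 0 < ε ∧ ∀ z : X × Y, ε ≤ p (f z.1) (g z.2) z.1 z.2 := by
    obtain h | h := isEmpty_or_nonempty (X × Y)
    · exact ⟨1, one_pos, fun z => h.elim z⟩
    · obtain ⟨z, hz⟩ := Finite.exists_min fun z : X × Y => p (f z.1) (g z.2) z.1 z.2
      exact ⟨_, hpos z.1 z.2, hz⟩
  have hq : 0 < min ε (1 / 2) := lt_min hε (by norm_num)
  exact hq.trans_le <| le_localContent hp f g hq.le
    ((min_le_right _ _).trans_lt (by norm_num)) fun x y => (min_le_left _ _).trans (hle (x, y))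

lemma IsLocal.exists_pos {q : A → B → X → Y → ℝ} (hq : IsLocal q) :
    ∃ (f : X → A) (g : Y → B), ∀ x y, 0 < q (f x) (g y) x y := by
  obtain ⟨μ, hμ, hsum, hq⟩ := hq
  obtain ⟨⟨f, g⟩, -, hfg⟩ := exists_lt_of_sum_lt (s := univ) (f := fun _ => (0 : ℝ)) (g := μ)
    (by simp [hsum])
  refine ⟨f, g, fun x y => ?_⟩
  rw [hq]
  exact sum_pos' (fun h _ => mul_nonneg (hμ h) (detLocal_nonneg _ _ _ _ _ _))
    ⟨(f, g), mem_univ _, by simpa [detLocal] using hfg⟩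

omit [DecidableEq A] [DecidableEq B] [DecidableEq X] [DecidableEq Y] in
/-- The no-signaling correlations realizing a table of zeros form a face. -/
lemma isFace_realizes (Z : Set (A × B × X × Y)) :
    IsFace {q : A → B → X → Y → ℝ | IsNSCorrelation q ∧ Realizes q Z} := by
  refine ⟨fun q hq => hq.1, fun q hq p₁ h₁ p₂ h₂ t ht0 ht1 hdec => ?_⟩
  have key : ∀ a b x y, (a, b, x, y) ∈ Z → p₁ a b x y = 0 ∧ p₂ a b x y = 0 := by
    intro a b x y hz
    have h := hdec a b x y
    rw [hq.2 a b x y hz, eq_comm, add_eq_zero_iff_of_nonneg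
      (mul_nonneg ht0.le (h₁.1.1 a b x y)) (mul_nonneg (sub_pos.2 ht1).le (h₂.1.1 a b x y))] at h
    exact ⟨(mul_eq_zero.1 h.1).resolve_left ht0.ne',
      (mul_eq_zero.1 h.2).resolve_left (sub_pos.2 ht1).ne'⟩
  exact ⟨⟨h₁, fun a b x y hz => (key a b x y hz).1⟩, ⟨h₂, fun a b x y hz => (key a b x y hz).2⟩⟩

/-- **FN implies FNS.** If a no-signaling correlation `p` has local content `0`, then `p`
lies in a face of the no-signaling set that contains no local correlation. -/
theorem fn_implies_fns [Nonempty A] [Nonempty B] [Nonempty X] [Nonempty Y]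
    (p : A → B → X → Y → ℝ) (hp : IsNSCorrelation p) (h0 : localContent p = 0) :
    ∃ F : Set (A → B → X → Y → ℝ), IsFace F ∧ p ∈ F ∧ ∀ q ∈ F, ¬ IsLocal q := by
  refine ⟨_, isFace_realizes {z | p z.1 z.2.1 z.2.2.1 z.2.2.2 = 0},
    ⟨hp, fun a b x y hz => hz⟩, fun q hq hloc => ?_⟩
  obtain ⟨f, g, hpos⟩ := hloc.exists_pos
  refine (localContent_pos hp f g fun x y => ?_).ne' h0
  exact (hp.1.1 _ _ x y).lt_of_ne' fun h => (hpos x y).ne' (hq.2 _ _ x y h)
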